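/- The Shapley–Shubik index Ψ for interval simple games is discretizable: for every approximable interval simple game v and every approximation sequence (f^h)_{h∈ℕ} of v, the limit lim_{h→∞} Ψ(f^h) exists and equals Ψ(v). -/

import Mathlib

open MeasureTheory

/-- The unit cube `[0,1]^n`. -/
def cube (n : ℕ) : Set (Fin n → ℝ) := {x | ∀ i, x i ∈ Set.Icc (0 : ℝ) 1}

/-- An interval simple game: a function `[0,1]^n → [0,1]` with `v(0)=0`, `v(1)=1`,
monotone on the cube. -/
def IsISG (n : ℕ) (v : (Fin n → ℝ) → ℝ) : Prop :=
  v (fun _ => 0) = 0 ∧ v (fun _ => 1) = 1 ∧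
  (∀ x ∈ cube n, v x ∈ Set.Icc (0 : ℝ) 1) ∧
  (∀ x ∈ cube n, ∀ y ∈ cube n, (∀ i, x i ≤ y i) → v x ≤ v y)

/-- The Shapley–Shubik index `Ψ` for interval simple games. -/
noncomputable def Psi (n : ℕ) (v : (Fin n → ℝ) → ℝ) (i : Fin n) : ℝ :=
  (1 / (n.factorial : ℝ)) * ∑ π : Equiv.Perm (Fin n),
    ∫ x in cube n,
      ((v (fun j => if π j < π i then x j else 1) -
        v (fun j => if π j < π i then x j else 0)) -
       (v (fun j => if π j ≤ π i then x j else 1) -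
        v (fun j => if π j ≤ π i then x j else 0)))

/-- A discretization `0 = α_0 < α_1 < … < α_p = 1` (encoded as a function `ℕ → ℝ`,
only the values `α_0,…,α_p` being relevant). -/
def IsDiscretization (p : ℕ) (α : ℕ → ℝ) : Prop :=
  1 ≤ p ∧ α 0 = 0 ∧ α p = 1 ∧ ∀ i < p, α i < α (i + 1)

/-- Half-integer indices `e ∈ A_p` are encoded as `e : Fin n → ℕ`, where the value `k`
stands for `k/2`; so even entries are integers and odd entries are half-integers.
`(α)_e` is the corresponding (partially open) box: coordinate `j` equals `α_{e_j}`
if `e_j` is an integer, and ranges in `(α_{e_j − 1/2}, α_{e_j + 1/2})` otherwise. -/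
def openBox (n : ℕ) (α : ℕ → ℝ) (e : Fin n → ℕ) : Set (Fin n → ℝ) :=
  {x | ∀ j, if e j % 2 = 0 then x j = α (e j / 2)
            else α (e j / 2) < x j ∧ x j < α (e j / 2 + 1)}

/-- The closed box `[α]_e`, the closure of `(α)_e`. -/
def closedBox (n : ℕ) (α : ℕ → ℝ) (e : Fin n → ℕ) : Set (Fin n → ℝ) :=
  {x | ∀ j, α (e j / 2) ≤ x j ∧ x j ≤ α ((e j + 1) / 2)}

/-- A step function with discretization `α ∈ D_p`: constant on `(α)_e` for every `e ∈ A_p`. -/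
def IsStepFun (n p : ℕ) (α : ℕ → ℝ) (f : (Fin n → ℝ) → ℝ) : Prop :=
  ∀ e : Fin n → ℕ, (∀ j, e j ≤ 2 * p) →
    ∀ x ∈ openBox n α e, ∀ y ∈ openBox n α e, f x = f y

/-- The element of `Ā_p` (all entries half-integers) encoded by `eb : Fin n → Fin p`:
entry `j` is the half-integer `eb_j + 1/2`, i.e. code `2·eb_j + 1`. -/
def fullIdx {n p : ℕ} (eb : Fin n → Fin p) : Fin n → ℕ := fun j => 2 * (eb j : ℕ) + 1

/-- The center `c_e` of the closed box `[α]_e`. -/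
noncomputable def center (n : ℕ) (α : ℕ → ℝ) (e : Fin n → ℕ) : Fin n → ℝ :=
  fun j => (α (e j / 2) + α ((e j + 1) / 2)) / 2

open Classical in
/-- `E(x)`: the set of full-dimensional boxes `eb ∈ Ā_p` with `x ∈ [α]_{eb}`. -/
noncomputable def Ecal (n p : ℕ) (α : ℕ → ℝ) (x : Fin n → ℝ) : Finset (Fin n → Fin p) :=
  Finset.univ.filter fun eb => x ∈ closedBox n α (fullIdx eb)

open Classical in
/-- A regular step function. -/
noncomputable def RegularStep (n p : ℕ) (α : ℕ → ℝ) (f : (Fin n → ℝ) → ℝ) : Prop :=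
  IsStepFun n p α f ∧ f (fun _ => 0) = 0 ∧ f (fun _ => 1) = 1 ∧
  ∀ x ∈ cube n, x ≠ (fun _ => (0 : ℝ)) → x ≠ (fun _ => (1 : ℝ)) →
    f x = (∑ eb ∈ Ecal n p α x, f (center n α (fullIdx eb))) / ((Ecal n p α x).card : ℝ)

open Classical in
/-- A semi-regular step function. -/
noncomputable def SemiRegularStep (n p : ℕ) (α : ℕ → ℝ) (f : (Fin n → ℝ) → ℝ) : Prop :=
  IsStepFun n p α f ∧
  ∀ x : Fin n → ℝ, (∀ j, 0 < x j ∧ x j < 1) →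
    f x = (∑ eb ∈ Ecal n p α x, f (center n α (fullIdx eb))) / ((Ecal n p α x).card : ℝ)
/-- `f` is an approximation of the interval simple game `v`: a regular step function with
discretization `α ∈ D_p` whose value on each full-dimensional open box `(α)_{ē}` is a
value of `v` attained somewhere on `[α]_{ē}`. -/
def IsApproximation (n p : ℕ) (α : ℕ → ℝ) (v f : (Fin n → ℝ) → ℝ) : Prop :=
  IsDiscretization p α ∧ RegularStep n p α f ∧
  ∀ eb : Fin n → Fin p, ∃ xe ∈ closedBox n α (fullIdx eb),
    ∀ y ∈ openBox n α (fullIdx eb), f y = v xe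

/-- `(F h)_{h∈ℕ}` (with discretizations `aseq h ∈ D_{pseq h}`) is an approximation sequence
of `v`: each `F h` is an approximation of `v`, the mesh `ω(aseq h)` tends to `0`, and
`sup_{x∈[0,1]^n} |v(x) − F h(x)|` tends to `0`. -/
def IsApproxSeq (n : ℕ) (v : (Fin n → ℝ) → ℝ) (pseq : ℕ → ℕ) (aseq : ℕ → ℕ → ℝ)
    (F : ℕ → (Fin n → ℝ) → ℝ) : Prop :=
  (∀ h : ℕ, IsApproximation n (pseq h) (aseq h) v (F h)) ∧
  (∀ δ : ℝ, 0 < δ → ∃ H : ℕ, ∀ h ≥ H, ∀ i < pseq h, aseq h (i + 1) - aseq h i < δ) ∧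
  (∀ δ : ℝ, 0 < δ → ∃ H : ℕ, ∀ h ≥ H, ∀ x ∈ cube n, |v x - F h x| < δ)

/-- `v` is approximable: it admits an approximation sequence. -/
def Approximable (n : ℕ) (v : (Fin n → ℝ) → ℝ) : Prop :=
  ∃ pseq : ℕ → ℕ, ∃ aseq : ℕ → ℕ → ℝ, ∃ F : ℕ → (Fin n → ℝ) → ℝ,
    IsApproxSeq n v pseq aseq F

/-- A power index `Φ` is discretizable (D): for every approximable interval simple game `v`
and every approximation sequence of `v`, `lim_{h→∞} Φ(F h)` exists and equals `Φ(v)`. -/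
def Discretizable (n : ℕ) (Φ : ((Fin n → ℝ) → ℝ) → Fin n → ℝ) : Prop :=
  ∀ v : (Fin n → ℝ) → ℝ, IsISG n v →
    ∀ pseq : ℕ → ℕ, ∀ aseq : ℕ → ℕ → ℝ, ∀ F : ℕ → (Fin n → ℝ) → ℝ,
      IsApproxSeq n v pseq aseq F →
      ∀ i : Fin n,
        Filter.Tendsto (fun h => Φ (F h) i) Filter.atTop (nhds (Φ v i))

open Filter Topology

/-- Every point between `α 0` and `α m` lies on a node or strictly between two consecutive nodes. -/
lemma exists_index_of_le (α : ℕ → ℝ) (t : ℝ) (h0 : α 0 ≤ t) (m : ℕ) (hm : t ≤ α m) :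
    ∃ e ≤ 2 * m, if e % 2 = 0 then t = α (e / 2) else α (e / 2) < t ∧ t < α (e / 2 + 1) := by
  induction m with
  | zero => exact ⟨0, le_rfl, by simpa using le_antisymm hm h0⟩
  | succ m ih =>
    rcases le_or_gt t (α m) with h | h
    · obtain ⟨e, he, h'⟩ := ih h
      exact ⟨e, by omega, h'⟩
    · rcases hm.eq_or_lt with h' | h'
      · refine ⟨2 * (m + 1), le_rfl, ?_⟩
        rw [if_pos (by omega), show 2 * (m + 1) / 2 = m + 1 by omega]
        exact h'
      · refine ⟨2 * m + 1, by omega, ?_⟩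
        rw [if_neg (by omega), show (2 * m + 1) / 2 = m by omega]
        exact ⟨h, h'⟩

lemma measurableSet_openBox (n : ℕ) (α : ℕ → ℝ) (e : Fin n → ℕ) :
    MeasurableSet (openBox n α e) := by
  have : openBox n α e = ⋂ j, {x : Fin n → ℝ | if e j % 2 = 0 then x j = α (e j / 2)
      else α (e j / 2) < x j ∧ x j < α (e j / 2 + 1)} := by
    ext x
    simp [openBox]
  rw [this]
  refine MeasurableSet.iInter fun j => ?_
  split_ifs
  · exact measurableSet_eq_fun (measurable_pi_apply j) measurable_const
  · exact (measurableSet_lt measurable_const (measurable_pi_apply j)).inter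
      (measurableSet_lt (measurable_pi_apply j) measurable_const)

lemma cube_eq_Icc (n : ℕ) : cube n = Set.Icc (0 : Fin n → ℝ) 1 := by
  ext x
  simp [cube, Pi.le_def, forall_and]

lemma measurableSet_cube (n : ℕ) : MeasurableSet (cube n) :=
  cube_eq_Icc n ▸ measurableSet_Icc

lemma IsStepFun.measurable_indicator {n p : ℕ} {α : ℕ → ℝ} {f : (Fin n → ℝ) → ℝ}
    (hα : IsDiscretization p α) (hf : IsStepFun n p α f) :
    Measurable ((cube n).indicator f) := by
  have hcover : ∀ x ∈ cube n, ∃ e : Fin n → ℕ, (∀ j, e j ≤ 2 * p) ∧ x ∈ openBox n α e := by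
    intro x hx
    choose e he hxe using fun j => exists_index_of_le α (x j) (hα.2.1.trans_le (hx j).1) p
      ((hx j).2.trans_eq hα.2.2.1.symm)
    exact ⟨e, he, hxe⟩
  have hpre : ∀ s : Set ℝ, MeasurableSet (cube n ∩ f ⁻¹' s) := by
    intro s
    have : cube n ∩ f ⁻¹' s = ⋃ e ∈ {e : Fin n → ℕ | (∀ j, e j ≤ 2 * p) ∧
        ∃ y ∈ openBox n α e, f y ∈ s}, cube n ∩ openBox n α e := by
      ext x
      simp only [Set.mem_inter_iff, Set.mem_preimage, Set.mem_iUnion, Set.mem_ofPred_eq,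
        exists_prop]
      constructor
      · rintro ⟨hx, hxs⟩
        obtain ⟨e, he, hxe⟩ := hcover x hx
        exact ⟨e, ⟨he, x, hxe, hxs⟩, hx, hxe⟩
      · rintro ⟨e, ⟨he, y, hy, hys⟩, hx, hxe⟩
        exact ⟨hx, hf e he x hxe y hy ▸ hys⟩
    rw [this]
    exact MeasurableSet.biUnion (Set.to_countable _) fun e _ =>
      (measurableSet_cube n).inter (measurableSet_openBox n α e)
  intro s hs
  classical
  rw [Set.indicator_preimage, Set.ite, Set.inter_comm]
  exact (hpre s).union ((measurable_const hs).diff (measurableSet_cube n))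

lemma IsApproxSeq.tendsto {n : ℕ} {v : (Fin n → ℝ) → ℝ} {pseq : ℕ → ℕ} {aseq : ℕ → ℕ → ℝ}
    {F : ℕ → (Fin n → ℝ) → ℝ} (hF : IsApproxSeq n v pseq aseq F) {x : Fin n → ℝ}
    (hx : x ∈ cube n) : Tendsto (fun h => F h x) atTop (𝓝 (v x)) := by
  refine Metric.tendsto_atTop.2 fun ε hε => ?_
  obtain ⟨H, hH⟩ := hF.2.2 ε hε
  exact ⟨H, fun h hh => by rw [dist_comm]; exact hH h hh x hx⟩

lemma IsApproxSeq.eventually_bounded {n : ℕ} {v : (Fin n → ℝ) → ℝ} {pseq : ℕ → ℕ}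
    {aseq : ℕ → ℕ → ℝ} {F : ℕ → (Fin n → ℝ) → ℝ} (hv : IsISG n v)
    (hF : IsApproxSeq n v pseq aseq F) :
    ∀ᶠ h in atTop, ∀ x ∈ cube n, |F h x| ≤ 2 := by
  obtain ⟨H, hH⟩ := hF.2.2 1 one_pos
  filter_upwards [eventually_ge_atTop H] with h hh x hx
  have h1 := abs_lt.1 (hH h hh x hx)
  have h2 := hv.2.2.1 x hx
  exact abs_le.2 ⟨by linarith [h2.1], by linarith [h2.2]⟩

/-- Replacing coordinates by a constant of `[0,1]` preserves the cube. -/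
lemma ite_mem_cube {n : ℕ} {x : Fin n → ℝ} (hx : x ∈ cube n) (P : Fin n → Prop)
    [DecidablePred P] {c : ℝ} (hc : c ∈ Set.Icc (0 : ℝ) 1) :
    (fun j => if P j then x j else c) ∈ cube n := by
  intro j
  dsimp only
  split_ifs
  exacts [hx j, hc]

lemma IsApproximation.aestronglyMeasurable_ite {n p : ℕ} {α : ℕ → ℝ} {v f : (Fin n → ℝ) → ℝ}
    (hf : IsApproximation n p α v f) (P : Fin n → Prop) [DecidablePred P] {c : ℝ}
    (hc : c ∈ Set.Icc (0 : ℝ) 1) :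
    AEStronglyMeasurable (fun x => f (fun j => if P j then x j else c))
      (volume.restrict (cube n)) := by
  have hsub : Measurable fun (x : Fin n → ℝ) (j : Fin n) => if P j then x j else c := by
    refine measurable_pi_lambda _ fun j => ?_
    split_ifs
    exacts [measurable_pi_apply j, measurable_const]
  have hmeas := (hf.2.1.1.measurable_indicator hf.1).comp hsub
  refine hmeas.aestronglyMeasurable.congr ?_
  filter_upwards [ae_restrict_mem (measurableSet_cube n)] with x hx
  exact Set.indicator_of_mem (ite_mem_cube hx P hc) f

/-- The Shapley–Shubik index `Ψ` for interval simple games is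
discretizable: for every approximable interval simple game `v` and every approximation
sequence `(f^h)` of `v`, `lim_{h→∞} Ψ(f^h)` exists and equals `Ψ(v)`. -/
theorem Psi_discretizable (n : ℕ) (hn : 1 ≤ n) : Discretizable n (Psi n) := by
  intro v hv pseq aseq F hF i
  refine Tendsto.const_mul _ (tendsto_finsetSum _ fun π _ => ?_)
  have h0 : (0 : ℝ) ∈ Set.Icc (0 : ℝ) 1 := by simp
  have h1 : (1 : ℝ) ∈ Set.Icc (0 : ℝ) 1 := by simp
  have : IsFiniteMeasure (volume.restrict (cube n)) :=
    isFiniteMeasure_restrict.2 (cube_eq_Icc n ▸ isCompact_Icc.measure_ne_top)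
  refine tendsto_integral_filter_of_dominated_convergence (fun _ => 8)
    (Eventually.of_forall fun h => ?_) ?_ (integrable_const _) ?_
  · have hm := fun (P : Fin n → Prop) [DecidablePred P] (c : ℝ) hc =>
      (hF.1 h).aestronglyMeasurable_ite P (c := c) hc
    exact ((hm _ 1 h1).sub (hm _ 0 h0)).sub ((hm _ 1 h1).sub (hm _ 0 h0))
  · filter_upwards [hF.eventually_bounded hv] with h hh
    filter_upwards [ae_restrict_mem (measurableSet_cube n)] with x hx
    have hb := fun (P : Fin n → Prop) [DecidablePred P] (c : ℝ) hc =>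
      abs_le.1 (hh _ (ite_mem_cube hx P (c := c) hc))
    have a := hb (fun j => π j < π i) 1 h1
    have b := hb (fun j => π j < π i) 0 h0
    have c := hb (fun j => π j ≤ π i) 1 h1
    have d := hb (fun j => π j ≤ π i) 0 h0
    rw [Real.norm_eq_abs, abs_le]
    constructor <;> linarith [a.1, a.2, b.1, b.2, c.1, c.2, d.1, d.2]
  · filter_upwards [ae_restrict_mem (measurableSet_cube n)] with x hx
    have ht := fun (P : Fin n → Prop) [DecidablePred P] (c : ℝ) hc =>
      hF.tendsto (ite_mem_cube hx P (c := c) hc)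
    exact ((ht _ 1 h1).sub (ht _ 0 h0)).sub ((ht _ 1 h1).sub (ht _ 0 h0))
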